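/- There exist infinitely many odd positive integers M such that for every natural number n, neither M + 2^n nor |M - 2^n| is a prime power. -/

import Mathlib

def csL : List ℕ := [3,5,7,11,13,17,19,31,37,41,61,73,97,109,151,241,257,331]

def csA : ℕ := 5560058544280730331978613134929038795603969

def csQ : ℕ := 9356805166945668623780751340276163637411840

lemma cs_prime : ∀ p ∈ csL, p.Prime := by
  intro p hp
  simp only [csL, List.mem_cons, List.not_mem_nil, or_false] at hp
  rcases hp with h | h | h | h | h | h | h | h | h | h | h | h | h | h | h | h | h | h <;>
    subst h <;> norm_num

lemma cs_facts : ∀ p ∈ csL, p ∣ csQ ∧ p % 2 = 1 ∧ p % 65537 ≠ 0 ∧ 2 ^ 720 % p = 1 := by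
  decide +kernel

lemma cs_pow : ∀ p ∈ csL, p ^ 65536 % 4294967296 ≠ 1 := by
  decide +kernel

lemma cs_cover_add : ∀ r < 720, ∃ p ∈ csL, (csA + 2 ^ r) % p = 0 := by
  decide +kernel

lemma cs_cover_sub : ∀ r < 720, ∃ p ∈ csL, csA % p = 2 ^ r % p := by
  decide +kernel

lemma cs_ord (p : ℕ) (hp : p ∈ csL) (m : ℕ) (h : (p : ZMod 4294967296) ^ m = 1) :
    2 ^ 17 ∣ m := by
  have hodd := (cs_facts p hp).2.1
  have hcop : Nat.Coprime p 4294967296 := by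
    have : Nat.Coprime p (2 ^ 32) :=
      Nat.Coprime.pow_right _ (Nat.coprime_two_right.mpr (Nat.odd_iff.mpr hodd))
    simpa using this
  have h1 : (p : ZMod 4294967296) ^ (2 ^ 31) = 1 := by
    have h2 := Nat.ModEq.pow_totient hcop
    have h3 : Nat.totient 4294967296 = 2 ^ 31 := by
      have := Nat.totient_prime_pow Nat.prime_two (n := 32) (by norm_num)
      norm_num at this ⊢
      exact this
    rw [h3] at h2
    have h4 := (ZMod.natCast_eq_natCast_iff _ _ _).mpr h2
    rw [Nat.cast_pow, Nat.cast_one] at h4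
    exact h4
  have h5 : ¬ (p : ZMod 4294967296) ^ (2 ^ 16) = 1 := by
    intro h6
    have h7 : ((p ^ 65536 : ℕ) : ZMod 4294967296) = ((1 : ℕ) : ZMod 4294967296) := by
      rw [Nat.cast_pow, Nat.cast_one]; exact h6
    have h8 := (ZMod.natCast_eq_natCast_iff _ _ _).mp h7
    exact cs_pow p hp h8
  obtain ⟨j, -, hj⟩ := (Nat.dvd_prime_pow Nat.prime_two).mp (orderOf_dvd_of_pow_eq_one h1)
  have h9 := orderOf_dvd_of_pow_eq_one h
  have h10 : 17 ≤ j := by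
    by_contra hlt
    apply h5
    apply orderOf_dvd_iff_pow_eq_one.mp
    rw [hj]
    exact pow_dvd_pow 2 (by omega)
  rw [hj] at h9
  exact (pow_dvd_pow 2 h10).trans h9

/-- A power of `p` that is `±1` modulo `2^32` is `1` modulo `65537` and modulo `4`. -/
lemma cs_key (p : ℕ) (hp : p ∈ csL) (k : ℕ)
    (h : (p : ZMod 4294967296) ^ k = 1 ∨ (p : ZMod 4294967296) ^ k = -1) :
    (p : ZMod 65537) ^ k = 1 ∧ (p : ZMod 4) ^ k = 1 := by
  obtain ⟨-, hodd, hne, -⟩ := cs_facts p hp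
  have h1 : (p : ZMod 4294967296) ^ (k * 2) = 1 := by
    rw [pow_mul]
    rcases h with h | h <;> rw [h] <;> ring
  obtain ⟨c, hc⟩ := cs_ord p hp _ h1
  have hk : k = 65536 * c := by omega
  constructor
  · have : Fact (Nat.Prime 65537) := ⟨by norm_num⟩
    have h0 : (p : ZMod 65537) ≠ 0 := by
      intro h0
      exact hne (Nat.mod_eq_zero_of_dvd ((ZMod.natCast_eq_zero_iff _ _).mp h0))
    have := ZMod.pow_card_sub_one_eq_one h0
    rw [hk, pow_mul]
    rw [show (65536 : ℕ) = 65537 - 1 from rfl, this, one_pow]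
  · have h2 : (p : ZMod 4) ^ 2 = 1 := by
      have h4 : p % 4 = 1 ∨ p % 4 = 3 := by omega
      rw [← ZMod.natCast_mod p 4]
      rcases h4 with h4 | h4 <;> rw [h4] <;> decide
    rw [hk, show 65536 * c = 2 * (32768 * c) by ring, pow_mul, h2, one_pow]

lemma cs_two_pow (n : ℕ) : (2 : ZMod 65537) ^ n ≠ 3 ∧ (2 : ZMod 65537) ^ n ≠ -3 := by
  have h : ∀ r < 32, 2 ^ r % 65537 ≠ 3 ∧ 2 ^ r % 65537 ≠ 65534 := by decide +kernel
  have h32 : (2 : ZMod 65537) ^ 32 = 1 := by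
    have : ((2 ^ 32 : ℕ) : ZMod 65537) = ((1 : ℕ) : ZMod 65537) :=
      (ZMod.natCast_eq_natCast_iff _ _ _).mpr (by decide +kernel)
    rw [Nat.cast_pow, Nat.cast_one] at this
    exact this
  rw [pow_eq_pow_mod n h32]
  obtain ⟨h1, h2⟩ := h (n % 32) (Nat.mod_lt _ (by norm_num))
  constructor
  · intro h3
    have : ((2 ^ (n % 32) : ℕ) : ZMod 65537) = ((3 : ℕ) : ZMod 65537) := by
      push_cast; exact h3
    exact h1 ((ZMod.natCast_eq_natCast_iff _ _ _).mp this)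
  · intro h3
    have : ((2 ^ (n % 32) : ℕ) : ZMod 65537) = ((65534 : ℕ) : ZMod 65537) := by
      push_cast; rw [h3]; decide +kernel
    exact h2 ((ZMod.natCast_eq_natCast_iff _ _ _).mp this)

lemma cs_eq_of_dvd {x p : ℕ} (hp : p.Prime) (hx : IsPrimePow x) (h : p ∣ x) :
    ∃ k, x = p ^ k := by
  obtain ⟨q, k, hq, -, rfl⟩ := hx
  have := (Nat.prime_dvd_prime_iff_eq hp hq.nat_prime).mp (hp.dvd_of_dvd_pow h)
  exact ⟨k, by rw [this]⟩

lemma cs_not_primePow {x p q : ℕ} (hp : p.Prime) (hq : q.Prime) (hne : p ≠ q)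
    (h1 : p ∣ x) (h2 : q ∣ x) : ¬ IsPrimePow x := by
  intro hx
  obtain ⟨k, rfl⟩ := cs_eq_of_dvd hp hx h1
  exact hne ((Nat.prime_dvd_prime_iff_eq hq hp).mp (hq.dvd_of_dvd_pow h2)).symm

lemma cs_cast {M m : ℕ} (hm : m ∣ csQ) (hM : M ≡ csA [MOD csQ]) : (M : ZMod m) = (csA : ZMod m) :=
  (ZMod.natCast_eq_natCast_iff _ _ _).mpr (hM.of_dvd hm)

lemma cs_two_pow_mod {p : ℕ} (hp : p ∈ csL) (n : ℕ) :
    (2 : ZMod p) ^ n = 2 ^ (n % 720) := by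
  apply pow_eq_pow_mod
  have h := (cs_facts p hp).2.2.2
  have h1 : 2 ^ 720 ≡ 1 [MOD p] := by
    have := (cs_prime p hp).one_lt
    rw [Nat.ModEq, h, Nat.mod_eq_of_lt this]
  have := (ZMod.natCast_eq_natCast_iff _ _ _).mpr h1
  rw [Nat.cast_pow, Nat.cast_one] at this
  exact this

lemma cs_add {M : ℕ} (hM : M ≡ csA [MOD csQ]) (n : ℕ) : ∃ p ∈ csL, p ∣ M + 2 ^ n := by
  obtain ⟨p, hp, h⟩ := cs_cover_add (n % 720) (Nat.mod_lt _ (by norm_num))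
  refine ⟨p, hp, ?_⟩
  rw [← ZMod.natCast_eq_zero_iff]
  have h1 := (ZMod.natCast_eq_zero_iff _ _).mpr (Nat.dvd_of_mod_eq_zero h)
  rw [Nat.cast_add, Nat.cast_pow] at h1 ⊢
  rw [cs_cast (cs_facts p hp).1 hM]
  have h2 := cs_two_pow_mod hp n
  rw [show ((2 : ℕ) : ZMod p) = 2 from rfl] at *
  rw [h2, h1]

lemma cs_sub {M : ℕ} (hM : M ≡ csA [MOD csQ]) (n : ℕ) :
    ∃ p ∈ csL, p ∣ ((M - 2 ^ n : ℤ).natAbs) := by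
  obtain ⟨p, hp, h⟩ := cs_cover_sub (n % 720) (Nat.mod_lt _ (by norm_num))
  refine ⟨p, hp, ?_⟩
  rw [← Int.natCast_dvd, ← ZMod.intCast_zmod_eq_zero_iff_dvd]
  have h1 := (ZMod.natCast_eq_natCast_iff _ _ _).mpr h
  rw [Nat.cast_pow] at h1
  rw [Int.cast_sub, Int.cast_pow, Int.cast_natCast, cs_cast (cs_facts p hp).1 hM, h1]
  have h2 := cs_two_pow_mod hp n
  rw [Int.cast_ofNat, h2]
  exact sub_self _

lemma cs_res {M : ℕ} (hM : M ≡ csA [MOD csQ]) :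
    (M : ZMod 4294967296) = 1 ∧ (M : ZMod 65537) = -2 ∧ (M : ZMod 4) = 1 := by
  refine ⟨?_, ?_, ?_⟩ <;> rw [cs_cast (by decide +kernel) hM] <;> decide +kernel

lemma cs_zero (n : ℕ) (hn : 32 ≤ n) :
    (2 : ZMod 4294967296) ^ n = 0 ∧ (2 : ZMod 4) ^ n = 0 := by
  obtain ⟨m, rfl⟩ := Nat.exists_eq_add_of_le hn
  have h1 : (2 : ZMod 4294967296) ^ 32 = 0 := by
    have : ((2 ^ 32 : ℕ) : ZMod 4294967296) = 0 :=
      (ZMod.natCast_eq_zero_iff _ _).mpr (by decide +kernel)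
    rw [Nat.cast_pow] at this
    exact this
  have h2 : (2 : ZMod 4) ^ 32 = 0 := by
    have : ((2 ^ 32 : ℕ) : ZMod 4) = 0 :=
      (ZMod.natCast_eq_zero_iff _ _).mpr (by decide +kernel)
    rw [Nat.cast_pow] at this
    exact this
  rw [pow_add, pow_add, h1, h2, zero_mul, zero_mul]
  exact ⟨rfl, rfl⟩

lemma cs_big_add {M : ℕ} (hM : M ≡ csA [MOD csQ]) (n : ℕ) (hn : 32 ≤ n) :
    ¬ IsPrimePow (M + 2 ^ n) := by
  intro hx
  obtain ⟨p, hp, hd⟩ := cs_add hM n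
  obtain ⟨k, hk⟩ := cs_eq_of_dvd (cs_prime p hp) hx hd
  obtain ⟨r1, r2, r3⟩ := cs_res hM
  obtain ⟨z1, z2⟩ := cs_zero n hn
  have e : ∀ m : ℕ, (M : ZMod m) + 2 ^ n = (p : ZMod m) ^ k := by
    intro m
    have := congrArg (Nat.cast : ℕ → ZMod m) hk
    push_cast at this
    exact this
  have e1 := e 4294967296
  rw [r1, z1, add_zero] at e1
  obtain ⟨k1, -⟩ := cs_key p hp k (Or.inl e1.symm)
  have e2 := e 65537
  rw [r2, k1] at e2
  apply (cs_two_pow n).1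
  linear_combination e2

lemma cs_big_sub {M : ℕ} (hM : M ≡ csA [MOD csQ]) (n : ℕ) (hn : 32 ≤ n) :
    ¬ IsPrimePow ((M - 2 ^ n : ℤ).natAbs) := by
  intro hx
  obtain ⟨p, hp, hd⟩ := cs_sub hM n
  obtain ⟨k, hk⟩ := cs_eq_of_dvd (cs_prime p hp) hx hd
  obtain ⟨r1, r2, r3⟩ := cs_res hM
  obtain ⟨z1, z2⟩ := cs_zero n hn
  rcases Int.natAbs_eq (M - 2 ^ n : ℤ) with h | h <;> rw [hk] at h
  · have e : ∀ m : ℕ, (M : ZMod m) - 2 ^ n = (p : ZMod m) ^ k := by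
      intro m
      have := congrArg (Int.cast : ℤ → ZMod m) h
      push_cast at this
      exact this
    have e1 := e 4294967296
    rw [r1, z1, sub_zero] at e1
    obtain ⟨k1, -⟩ := cs_key p hp k (Or.inl e1.symm)
    have e2 := e 65537
    rw [r2, k1] at e2
    apply (cs_two_pow n).2
    linear_combination -e2
  · have e : ∀ m : ℕ, (M : ZMod m) - 2 ^ n = -(p : ZMod m) ^ k := by
      intro m
      have := congrArg (Int.cast : ℤ → ZMod m) h
      push_cast at this
      exact this
    have e1 := e 4294967296
    rw [r1, z1, sub_zero] at e1
    obtain ⟨-, k2⟩ := cs_key p hp k (Or.inr (by rw [e1, neg_neg]))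
    have e2 := e 4
    rw [r3, z2, k2] at e2
    revert e2
    decide

lemma cs_crt (N Q a : ℕ) (hQ : 0 < Q) : ∃ Q' a', 0 < Q' ∧ Q ∣ Q' ∧ a' ≡ a [MOD Q] ∧
    ∀ n < N, (∃ q, q.Prime ∧ q ∣ Q' ∧ ¬ q ∣ Q ∧ (q : ℤ) ∣ a' + 2 ^ n) ∧
      (∃ q, q.Prime ∧ q ∣ Q' ∧ ¬ q ∣ Q ∧ (q : ℤ) ∣ a' - 2 ^ n) := by
  have step : ∀ (Q a : ℕ) (c : ℤ), 0 < Q → ∃ Q' a', 0 < Q' ∧ Q ∣ Q' ∧ a' ≡ a [MOD Q] ∧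
      ∃ q, q.Prime ∧ q ∣ Q' ∧ ¬ q ∣ Q ∧ (q : ℤ) ∣ a' - c := by
    intro Q a c hQ
    obtain ⟨q, hq, hqp⟩ := Nat.exists_infinite_primes (Q + 1)
    have hnd : ¬ q ∣ Q := fun h => by have := Nat.le_of_dvd hQ h; omega
    have hcop : Nat.Coprime Q q := ((Nat.Prime.coprime_iff_not_dvd hqp).mpr hnd).symm
    obtain ⟨x, hx1, hx2⟩ := Nat.chineseRemainder hcop a (c % q).toNat
    refine ⟨Q * q, x, Nat.mul_pos hQ hqp.pos, dvd_mul_right _ _, hx1, q, hqp,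
      dvd_mul_left _ _, hnd, ?_⟩
    have h1 : ((c % q).toNat : ℤ) = c % q :=
      Int.toNat_of_nonneg (Int.emod_nonneg _ (by exact_mod_cast hqp.ne_zero))
    have h2 : (x : ℤ) ≡ c % q [ZMOD q] := by
      rw [← h1]; exact (Int.natCast_modEq_iff).mpr hx2
    have h3 : (x : ℤ) ≡ c [ZMOD q] := h2.trans (Int.mod_modEq _ _)
    exact h3.symm.dvd
  induction N with
  | zero => exact ⟨Q, a, hQ, dvd_rfl, rfl, fun n hn => absurd hn (Nat.not_lt_zero n)⟩
  | succ N ih =>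
    obtain ⟨Q1, a1, hQ1, hd1, hm1, h1⟩ := ih
    obtain ⟨Q2, a2, hQ2, hd2, hm2, q, hq, hqQ, hqn, hqd⟩ := step Q1 a1 (-2 ^ N) hQ1
    obtain ⟨Q3, a3, hQ3, hd3, hm3, r, hr, hrQ, hrn, hrd⟩ := step Q2 a2 (2 ^ N) hQ2
    have hm31 : a3 ≡ a1 [MOD Q1] := (hm3.of_dvd hd2).trans hm2
    have tr : ∀ (u v : ℕ) (w : ℕ) (c : ℤ), u ≡ v [MOD w] → (w : ℤ) ∣ v + c → (w : ℤ) ∣ u + c := by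
      intro u v w c h hh
      have h1 : (v : ℤ) ≡ u [ZMOD w] := Int.natCast_modEq_iff.mpr h.symm
      have h2 := dvd_add h1.dvd hh
      have h3 : (u : ℤ) - v + (v + c) = u + c := by ring
      rwa [h3] at h2
    refine ⟨Q3, a3, hQ3, hd1.trans (hd2.trans hd3), (hm31.of_dvd hd1).trans hm1, ?_⟩
    intro n hn
    rcases Nat.lt_succ_iff_lt_or_eq.mp hn with hn | rfl
    · obtain ⟨⟨s, hs, hsQ, hsn, hsd⟩, ⟨t, ht, htQ, htn, htd⟩⟩ := h1 n hn
      refine ⟨⟨s, hs, hsQ.trans (hd2.trans hd3), hsn, tr _ _ _ _ (hm31.of_dvd hsQ) hsd⟩,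
        ⟨t, ht, htQ.trans (hd2.trans hd3), htn, ?_⟩⟩
      rw [sub_eq_add_neg] at htd ⊢
      exact tr _ _ _ _ (hm31.of_dvd htQ) htd
    · refine ⟨⟨q, hq, hqQ.trans hd3, fun h => hqn (h.trans hd1), ?_⟩,
        ⟨r, hr, hrQ, fun h => hrn (h.trans (hd1.trans hd2)), hrd⟩⟩
      have : (q : ℤ) ∣ a2 + 2 ^ n := by simpa using hqd
      exact tr _ _ _ _ (hm3.of_dvd hqQ) this

theorem cohen_selfridge :
    {M : ℕ | Odd M ∧ 0 < M ∧ ∀ n : ℕ,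
      ¬ IsPrimePow (M + 2 ^ n) ∧
      ¬ IsPrimePow ((M - 2 ^ n : ℤ).natAbs)}.Infinite := by
  obtain ⟨Q, a, hQ, hd, ha, h⟩ := cs_crt 32 csQ csA (by decide +kernel)
  have hinf : {M : ℕ | 0 < M ∧ M ≡ a [MOD Q]}.Infinite := by
    rw [Set.infinite_iff_exists_gt]
    intro b
    refine ⟨a + Q * (b + 1), ⟨?_, ?_⟩, ?_⟩
    · have := Nat.le_mul_of_pos_left (b + 1) hQ; omega
    · simp [Nat.ModEq]
    · have := Nat.le_mul_of_pos_left (b + 1) hQ; omega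
  refine hinf.mono ?_
  rintro M ⟨hpos, hMa⟩
  have hM : M ≡ csA [MOD csQ] := (hMa.of_dvd hd).trans ha
  refine ⟨?_, hpos, ?_⟩
  · have h2 : M ≡ csA [MOD 2] := hM.of_dvd (by decide +kernel)
    have h3 : csA % 2 = 1 := by decide +kernel
    rw [Nat.odd_iff, ← h3]
    exact h2
  · intro n
    by_cases hn : 32 ≤ n
    · exact ⟨cs_big_add hM n hn, cs_big_sub hM n hn⟩
    · obtain ⟨⟨q, hq, hqQ, hqn, hqd⟩, ⟨r, hr, hrQ, hrn, hrd⟩⟩ := h n (by omega)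
      have tr : ∀ w : ℕ, w ∣ Q → (w : ℤ) ∣ (M : ℤ) - a := fun w hw =>
        (Int.natCast_modEq_iff.mpr (hMa.of_dvd hw).symm).dvd
      constructor
      · obtain ⟨p, hp, hpd⟩ := cs_add hM n
        refine cs_not_primePow (cs_prime p hp) hq ?_ hpd ?_
        · rintro rfl; exact hqn (cs_facts _ hp).1
        · have := dvd_add (tr q hqQ) hqd
          rw [show (M : ℤ) - a + (a + 2 ^ n) = ((M + 2 ^ n : ℕ) : ℤ) by push_cast; ring] at this
          exact_mod_cast this
      · obtain ⟨p, hp, hpd⟩ := cs_sub hM n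
        refine cs_not_primePow (cs_prime p hp) hr ?_ hpd ?_
        · rintro rfl; exact hrn (cs_facts _ hp).1
        · have := dvd_add (tr r hrQ) hrd
          rw [show (M : ℤ) - a + (a - 2 ^ n) = M - 2 ^ n by ring] at this
          exact Int.natCast_dvd.mp this
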